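/- arXiv:1310.2897 — 2 statements merged into one kernel-verified Lean document; each statement's English description precedes it below -/
import Mathlib

section
/- A subset O of the points of GQ(2,2) meets every line in exactly one point if and only if O = e_i for some i ∈ Fin 6, where e_i is the set of all 2-element subsets of Fin 6 containing i. In particular, GQ(2,2) has exactly 6 ovoids. -/
/-- The points of GQ(2,2): the 2-element subsets of `Fin 6`. -/
abbrev GQP : Type := {s : Finset (Fin 6) // s.card = 2}

/-- The lines of GQ(2,2): 3-element sets of pairwise disjoint 2-element subsets of `Fin 6`. -/
def GQLine (L : Finset GQP) : Prop :=
  L.card = 3 ∧ ∀ p ∈ L, ∀ q ∈ L, p ≠ q → Disjoint p.1 q.1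

/-- `ovoidE i` is the set of all 2-element subsets of `Fin 6` containing `i`. -/
def ovoidE (i : Fin 6) : Finset GQP := Finset.univ.filter (fun p : GQP => i ∈ p.1)


/-- The point `{a, b}` of GQ(2,2). -/
def pt (a b : Fin 6) (h : a ≠ b := by decide) : GQP := ⟨{a, b}, Finset.card_pair h⟩

/-- Exactly one of three Booleans is true. -/
def oneOf (x y z : Bool) : Bool := (x && !y && !z) || (!x && y && !z) || (!x && !y && z)

set_option maxRecDepth 100000 in
set_option synthInstance.maxSize 100000 in
set_option synthInstance.maxHeartbeats 2000000 in
set_option maxHeartbeats 4000000 in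
/-- The Boolean form of the classification: one constraint for each of the 15 lines. -/
theorem key :
    ∀ x01 x23 x45 : Bool,
    oneOf x01 x23 x45 = true →
    ∀ x24 x35 : Bool,
    oneOf x01 x24 x35 = true →
    ∀ x25 x34 : Bool,
    oneOf x01 x25 x34 = true →
    ∀ x02 x13 : Bool,
    oneOf x02 x13 x45 = true →
    ∀ x14 : Bool,
    oneOf x02 x14 x35 = true →
    ∀ x15 : Bool,
    oneOf x02 x15 x34 = true →
    ∀ x03 x12 : Bool,
    oneOf x03 x12 x45 = true →
    oneOf x03 x14 x25 = true →
    oneOf x03 x15 x24 = true →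
    ∀ x04 : Bool,
    oneOf x04 x12 x35 = true →
    oneOf x04 x13 x25 = true →
    oneOf x04 x15 x23 = true →
    ∀ x05 : Bool,
    oneOf x05 x12 x34 = true →
    oneOf x05 x13 x24 = true →
    oneOf x05 x14 x23 = true →
    (∃ i : Fin 6, x01 = decide (i = 0 ∨ i = 1) ∧
      x02 = decide (i = 0 ∨ i = 2) ∧
      x03 = decide (i = 0 ∨ i = 3) ∧
      x04 = decide (i = 0 ∨ i = 4) ∧
      x05 = decide (i = 0 ∨ i = 5) ∧
      x12 = decide (i = 1 ∨ i = 2) ∧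
      x13 = decide (i = 1 ∨ i = 3) ∧
      x14 = decide (i = 1 ∨ i = 4) ∧
      x15 = decide (i = 1 ∨ i = 5) ∧
      x23 = decide (i = 2 ∨ i = 3) ∧
      x24 = decide (i = 2 ∨ i = 4) ∧
      x25 = decide (i = 2 ∨ i = 5) ∧
      x34 = decide (i = 3 ∨ i = 4) ∧
      x35 = decide (i = 3 ∨ i = 5) ∧
      x45 = decide (i = 4 ∨ i = 5)) := by
  decide +kernel

theorem line_oneOf (O : Finset GQP) (h : ∀ L : Finset GQP, GQLine L → (L ∩ O).card = 1)
    (p q r : GQP) (hpq : Disjoint p.1 q.1) (hpr : Disjoint p.1 r.1) (hqr : Disjoint q.1 r.1) :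
    oneOf (decide (p ∈ O)) (decide (q ∈ O)) (decide (r ∈ O)) = true := by
  have ne : ∀ s t : GQP, Disjoint s.1 t.1 → s ≠ t := by
    rintro s t hd rfl
    have h2 := s.2
    rw [disjoint_self.1 hd] at h2
    simp at h2
  have n1 := ne _ _ hpq
  have n2 := ne _ _ hpr
  have n3 := ne _ _ hqr
  have hL := h {p, q, r} ⟨Finset.card_eq_three.2 ⟨p, q, r, n1, n2, n3, rfl⟩, by
    intro s hs t ht hst
    simp only [Finset.mem_insert, Finset.mem_singleton] at hs ht
    rcases hs with rfl | rfl | rfl <;> rcases ht with rfl | rfl | rfl <;>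
      first
        | exact absurd rfl hst
        | assumption
        | (apply Disjoint.symm; assumption)⟩
  by_cases hp : p ∈ O <;> by_cases hq : q ∈ O <;> by_cases hr : r ∈ O <;>
    simp_all [oneOf, Finset.insert_inter_of_mem, Finset.insert_inter_of_notMem]

theorem pts_all : ∀ p : GQP, p ∈ [pt 0 1, pt 0 2, pt 0 3, pt 0 4, pt 0 5, pt 1 2, pt 1 3, pt 1 4, pt 1 5, pt 2 3, pt 2 4, pt 2 5, pt 3 4, pt 3 5, pt 4 5] := by
  decide +kernel

theorem ovoidE_meets (i : Fin 6) (L : Finset GQP) (hL : GQLine L) :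
    (L ∩ ovoidE i).card = 1 := by
  obtain ⟨h3, hd⟩ := hL
  have hc : (L.biUnion (fun p => p.1)).card = 6 := by
    rw [Finset.card_biUnion hd, Finset.sum_congr rfl (fun p _ => p.2)]
    simp [h3]
  have hu : L.biUnion (fun p => p.1) = Finset.univ := by
    rw [← Finset.card_eq_iff_eq_univ, hc]; rfl
  have hi : i ∈ L.biUnion (fun p => p.1) := by rw [hu]; exact Finset.mem_univ i
  obtain ⟨p, hp, hip⟩ := Finset.mem_biUnion.1 hi
  refine Finset.card_eq_one.2 ⟨p, ?_⟩
  ext q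
  simp only [ovoidE, Finset.mem_inter, Finset.mem_filter, Finset.mem_univ, true_and,
    Finset.mem_singleton]
  constructor
  · rintro ⟨hq, hiq⟩
    by_contra hne
    exact Finset.disjoint_left.1 (hd q hq p hp hne) hiq hip
  · rintro rfl
    exact ⟨hp, hip⟩

theorem ovoid_eq (O : Finset GQP) (h : ∀ L : Finset GQP, GQLine L → (L ∩ O).card = 1) :
    ∃ i : Fin 6, O = ovoidE i := by
  have hl := line_oneOf O h
  obtain ⟨i, h01, h02, h03, h04, h05, h12, h13, h14, h15, h23, h24, h25, h34, h35, h45⟩ := key _ _ _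
      (hl (pt 0 1) (pt 2 3) (pt 4 5) (by decide) (by decide) (by decide)) _ _
      (hl (pt 0 1) (pt 2 4) (pt 3 5) (by decide) (by decide) (by decide)) _ _
      (hl (pt 0 1) (pt 2 5) (pt 3 4) (by decide) (by decide) (by decide)) _ _
      (hl (pt 0 2) (pt 1 3) (pt 4 5) (by decide) (by decide) (by decide)) _
      (hl (pt 0 2) (pt 1 4) (pt 3 5) (by decide) (by decide) (by decide)) _
      (hl (pt 0 2) (pt 1 5) (pt 3 4) (by decide) (by decide) (by decide)) _ _
      (hl (pt 0 3) (pt 1 2) (pt 4 5) (by decide) (by decide) (by decide))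
      (hl (pt 0 3) (pt 1 4) (pt 2 5) (by decide) (by decide) (by decide))
      (hl (pt 0 3) (pt 1 5) (pt 2 4) (by decide) (by decide) (by decide)) _
      (hl (pt 0 4) (pt 1 2) (pt 3 5) (by decide) (by decide) (by decide))
      (hl (pt 0 4) (pt 1 3) (pt 2 5) (by decide) (by decide) (by decide))
      (hl (pt 0 4) (pt 1 5) (pt 2 3) (by decide) (by decide) (by decide)) _
      (hl (pt 0 5) (pt 1 2) (pt 3 4) (by decide) (by decide) (by decide))
      (hl (pt 0 5) (pt 1 3) (pt 2 4) (by decide) (by decide) (by decide))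
      (hl (pt 0 5) (pt 1 4) (pt 2 3) (by decide) (by decide) (by decide))
  refine ⟨i, ?_⟩
  ext p
  have hp := pts_all p
  simp only [List.mem_cons, List.not_mem_nil, or_false] at hp
  simp only [ovoidE, Finset.mem_filter, Finset.mem_univ, true_and]
  rcases hp with rfl | rfl | rfl | rfl | rfl | rfl | rfl | rfl | rfl | rfl | rfl | rfl | rfl | rfl | rfl <;>
    simp only [pt, Finset.mem_insert, Finset.mem_singleton] at * <;>
    apply decide_eq_decide.1 <;> assumption

theorem ovoidE_injective : Function.Injective ovoidE := by
  intro i j hij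
  by_contra hne
  have sep : ∀ i j : Fin 6, i ≠ j → ∃ p : GQP, i ∈ p.1 ∧ j ∉ p.1 := by decide +kernel
  obtain ⟨p, h1, h2⟩ := sep i j hne
  have hp : p ∈ ovoidE i := by simp [ovoidE, h1]
  rw [hij] at hp
  simp [ovoidE, h2] at hp

theorem GQ_ovoids :
    (∀ O : Finset GQP,
      (∀ L : Finset GQP, GQLine L → (L ∩ O).card = 1) ↔ ∃ i : Fin 6, O = ovoidE i) ∧
    Nat.card {O : Finset GQP // ∀ L : Finset GQP, GQLine L → (L ∩ O).card = 1} = 6 := by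
  refine ⟨fun O => ⟨ovoid_eq O, ?_⟩, ?_⟩
  · rintro ⟨i, rfl⟩
    exact ovoidE_meets i
  · let f : Fin 6 → {O : Finset GQP // ∀ L : Finset GQP, GQLine L → (L ∩ O).card = 1} :=
      fun i => ⟨ovoidE i, ovoidE_meets i⟩
    have hf : Function.Bijective f := by
      refine ⟨fun i j hij => ovoidE_injective (congrArg Subtype.val hij), ?_⟩
      rintro ⟨O, hO⟩
      obtain ⟨i, rfl⟩ := ovoid_eq O hO
      exact ⟨i, rfl⟩
    rw [← Nat.card_congr (Equiv.ofBijective f hf)]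
    simp
end

section
/- Let M be the quotient of the F2-vector space (Fin 6 → ZMod 2) by the span of the constant function 1, with the action of Perm (Fin 6) induced by permuting coordinates. Then the number of orbits of this action on the set of 2-dimensional F2-subspaces of M is exactly 5. -/
/-- The span of the constant function `1` in `Fin n → ZMod 2`. -/
def constSpan (n : ℕ) : Submodule (ZMod 2) (Fin n → ZMod 2) :=
  Submodule.span (ZMod 2) {fun _ => 1}

/-- `M`, the quotient of `Fin 6 → ZMod 2` by the span of the constant function `1`. -/
abbrev Mspace := (Fin 6 → ZMod 2) ⧸ constSpan 6

/-- The linear automorphism of `Fin n → ZMod 2` given by permuting coordinates: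
`(σ • f) i = f (σ⁻¹ i)`. -/
def permFun {n : ℕ} (σ : Equiv.Perm (Fin n)) :
    (Fin n → ZMod 2) ≃ₗ[ZMod 2] (Fin n → ZMod 2) :=
  LinearEquiv.funCongrLeft (ZMod 2) (ZMod 2) σ.symm

lemma constSpan_map {n : ℕ} (σ : Equiv.Perm (Fin n)) :
    (constSpan n).map (permFun σ : (Fin n → ZMod 2) →ₗ[ZMod 2] (Fin n → ZMod 2))
      = constSpan n := by
  have h : (permFun σ) (fun _ => 1) = (fun _ => (1 : ZMod 2)) := rfl
  simp [constSpan, Submodule.map_span, Set.image_singleton, h]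

/-- The induced linear action of `Equiv.Perm (Fin n)` on the quotient
`(Fin n → ZMod 2) ⧸ constSpan n`. -/
def quotPerm {n : ℕ} (σ : Equiv.Perm (Fin n)) :
    ((Fin n → ZMod 2) ⧸ constSpan n) ≃ₗ[ZMod 2] ((Fin n → ZMod 2) ⧸ constSpan n) :=
  Submodule.Quotient.equiv _ _ (permFun σ) (constSpan_map σ)

/-- even-weight functions on four points (equivalently affine functions on `F₂²`). -/
def evenSub : Submodule (ZMod 2) (Fin 4 → ZMod 2) where
  carrier := {φ | φ 0 + φ 1 + φ 2 + φ 3 = 0}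
  add_mem' := by
    intro a b ha hb
    simp only [Set.mem_ofPred_eq, Pi.add_apply] at *
    linear_combination ha + hb
  zero_mem' := by simp
  smul_mem' := by
    intro c a ha
    simp only [Set.mem_ofPred_eq, Pi.smul_apply, smul_eq_mul] at *
    linear_combination c * ha

lemma mem_evenSub (φ : Fin 4 → ZMod 2) : φ ∈ evenSub ↔ φ 0 + φ 1 + φ 2 + φ 3 = 0 := Iff.rfl

lemma evenSub_perm (τ : Equiv.Perm (Fin 4)) (φ : Fin 4 → ZMod 2) (hφ : φ ∈ evenSub) :
    φ ∘ τ ∈ evenSub := by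
  rw [mem_evenSub] at *
  have := Equiv.sum_comp τ φ
  simp only [Fin.sum_univ_four] at this
  simpa [this] using hφ

/-- The subspace of `M` attached to a labelling of the six points by four labels. -/
def lineOf (h : Fin 6 → Fin 4) : Submodule (ZMod 2) Mspace :=
  evenSub.map ((constSpan 6).mkQ ∘ₗ LinearMap.funLeft (ZMod 2) (ZMod 2) h)

lemma mem_lineOf (h : Fin 6 → Fin 4) (x : Mspace) :
    x ∈ lineOf h ↔ ∃ φ ∈ evenSub, (Submodule.Quotient.mk (φ ∘ h) : Mspace) = x := Iff.rfl

lemma mk_eq_iff (f g : Fin 6 → ZMod 2) :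
    (Submodule.Quotient.mk f : Mspace) = Submodule.Quotient.mk g ↔
      ∃ c : ZMod 2, ∀ i, f i = g i + c := by
  rw [Submodule.Quotient.eq, constSpan, Submodule.mem_span_singleton]
  constructor
  · rintro ⟨c, hc⟩
    refine ⟨c, fun i => ?_⟩
    have := congrFun hc i
    simp at this
    rw [this]; ring
  · rintro ⟨c, hc⟩
    refine ⟨c, ?_⟩
    ext i
    simp [hc i]

lemma lineOf_comp_left (h : Fin 6 → Fin 4) (τ : Equiv.Perm (Fin 4)) :
    lineOf (τ ∘ h) = lineOf h := by
  ext x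
  simp only [mem_lineOf]
  constructor
  · rintro ⟨φ, hφ, rfl⟩
    exact ⟨φ ∘ τ, evenSub_perm τ φ hφ, rfl⟩
  · rintro ⟨φ, hφ, rfl⟩
    refine ⟨φ ∘ τ.symm, evenSub_perm τ.symm φ hφ, ?_⟩
    congr 1
    ext i
    simp

lemma quotPerm_mk (σ : Equiv.Perm (Fin 6)) (f : Fin 6 → ZMod 2) :
    quotPerm σ (Submodule.Quotient.mk f : Mspace) = Submodule.Quotient.mk (f ∘ σ.symm) := rfl

lemma lineOf_map (h : Fin 6 → Fin 4) (σ : Equiv.Perm (Fin 6)) :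
    (lineOf h).map (quotPerm σ : Mspace →ₗ[ZMod 2] Mspace) = lineOf (h ∘ σ.symm) := by
  ext x
  simp only [Submodule.mem_map, mem_lineOf]
  constructor
  · rintro ⟨_, ⟨φ, hφ, rfl⟩, rfl⟩
    exact ⟨φ, hφ, rfl⟩
  · rintro ⟨φ, hφ, rfl⟩
    exact ⟨_, ⟨φ, hφ, rfl⟩, rfl⟩

/-- Triples of points not separated by a subspace. -/
def agree (W : Submodule (ZMod 2) Mspace) : Set (Fin 6 × Fin 6 × Fin 6) :=
  {p | ∀ f : Fin 6 → ZMod 2, (Submodule.Quotient.mk f : Mspace) ∈ W →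
    f p.1 = f p.2.1 ∧ f p.1 = f p.2.2}

lemma agree_map (W : Submodule (ZMod 2) Mspace) (σ : Equiv.Perm (Fin 6)) :
    (agree (W.map (quotPerm σ : Mspace →ₗ[ZMod 2] Mspace))).ncard = (agree W).ncard := by
  have : agree (W.map (quotPerm σ : Mspace →ₗ[ZMod 2] Mspace)) =
      (Equiv.prodCongr σ (Equiv.prodCongr σ σ)) '' agree W := by
    rw [Equiv.image_eq_preimage_symm]
    ext ⟨i, j, k⟩
    simp only [agree, Set.mem_ofPred_eq, Set.mem_preimage]
    constructor
    · intro H f hf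
      exact H (f ∘ σ.symm) ⟨_, hf, rfl⟩
    · intro H f hf
      obtain ⟨y, hy, hyf⟩ := hf
      have : y = Submodule.Quotient.mk (f ∘ σ) := by
        apply (quotPerm σ).injective
        rw [quotPerm_mk]
        refine hyf.trans ?_
        congr 1
        ext i
        simp
      subst this
      simpa using H (f ∘ σ) hy
  rw [this, Set.ncard_image_of_injective _ (Equiv.injective _)]

lemma separate : ∀ x y : Fin 4, x ≠ y → ∃ z w : Fin 4,
    (fun t => if t = z ∨ t = w then (1 : ZMod 2) else 0) x ≠
      (fun t => if t = z ∨ t = w then (1 : ZMod 2) else 0) y ∧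
    (fun t => if t = z ∨ t = w then (1 : ZMod 2) else 0) ∈ evenSub := by
  simp only [mem_evenSub]
  decide

lemma agree_lineOf (h : Fin 6 → Fin 4) :
    (agree (lineOf h)).ncard =
      (Finset.univ.filter fun p : Fin 6 × Fin 6 × Fin 6 =>
        h p.1 = h p.2.1 ∧ h p.1 = h p.2.2).card := by
  rw [← Set.ncard_coe_finset]
  congr 1
  ext ⟨i, j, k⟩
  simp only [agree, Set.mem_ofPred_eq, Finset.coe_filter, Finset.mem_univ, true_and]
  constructor
  · intro H
    constructor
    · by_contra hne
      obtain ⟨z, w, h1, h2⟩ := separate _ _ hne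
      exact h1 (H _ ((mem_lineOf _ _).2 ⟨_, h2, rfl⟩)).1
    · by_contra hne
      obtain ⟨z, w, h1, h2⟩ := separate _ _ hne
      exact h1 (H _ ((mem_lineOf _ _).2 ⟨_, h2, rfl⟩)).2
  · rintro ⟨h1, h2⟩ f hf
    obtain ⟨φ, hφ, hf⟩ := (mem_lineOf _ _).1 hf
    obtain ⟨c, hc⟩ := (mk_eq_iff _ _).1 hf.symm
    simp [hc, h1]
    rw [← h2, h1]

/-- The two coordinates of a label. -/
def cA : Fin 4 → ZMod 2 := ![0, 0, 1, 1]
/-- The two coordinates of a label. -/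
def cB : Fin 4 → ZMod 2 := ![0, 1, 0, 1]
/-- The label with given coordinates. -/
def enc (x y : ZMod 2) : Fin 4 :=
  if x = 0 then (if y = 0 then 0 else 1) else (if y = 0 then 2 else 3)

lemma cA_enc : ∀ x y, cA (enc x y) = x := by decide
lemma cB_enc : ∀ x y, cB (enc x y) = y := by decide

lemma lineOf_eq_span (h : Fin 6 → Fin 4) :
    lineOf h = Submodule.span (ZMod 2)
      {(Submodule.Quotient.mk (cA ∘ h) : Mspace), Submodule.Quotient.mk (cB ∘ h)} := by
  ext x
  rw [mem_lineOf, Submodule.mem_span_pair]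
  constructor
  · rintro ⟨φ, hφ, rfl⟩
    refine ⟨φ 2 - φ 0, φ 1 - φ 0, ?_⟩
    rw [← Submodule.Quotient.mk_smul, ← Submodule.Quotient.mk_smul, ← Submodule.Quotient.mk_add,
      mk_eq_iff]
    refine ⟨- φ 0, fun i => ?_⟩
    have key : ∀ p q r s : ZMod 2, p + q + r + s = 0 → ∀ x : Fin 4,
      (r - p) * cA x + (q - p) * cB x = ![p, q, r, s] x + - p := by decide
    have e : φ = ![φ 0, φ 1, φ 2, φ 3] := by
      ext i; fin_cases i <;> rfl
    have := key _ _ _ _ hφ (h i)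
    rw [← e] at this
    simpa using this
  · rintro ⟨s, t, rfl⟩
    refine ⟨s • cA + t • cB, ?_, rfl⟩
    rw [mem_evenSub]
    revert s t
    decide

lemma lin_indep_iff (h : Fin 6 → Fin 4) :
    LinearIndependent (ZMod 2) ![(Submodule.Quotient.mk (cA ∘ h) : Mspace),
      Submodule.Quotient.mk (cB ∘ h)] ↔
    ∀ s t c : ZMod 2, (∀ i, s * cA (h i) + t * cB (h i) = c) → s = 0 ∧ t = 0 := by
  rw [LinearIndependent.pair_iff]
  refine forall₂_congr fun s t => ?_
  rw [← Submodule.Quotient.mk_smul, ← Submodule.Quotient.mk_smul, ← Submodule.Quotient.mk_add,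
      ← Submodule.Quotient.mk_zero, mk_eq_iff]
  simp

/-- The five standard labellings. -/
def stdLab : Fin 5 → Fin 6 → Fin 4 :=
  ![![1, 2, 3, 3, 3, 3], ![1, 2, 2, 3, 3, 3], ![1, 1, 2, 2, 3, 3], ![0, 1, 2, 3, 3, 3],
    ![0, 1, 2, 2, 3, 3]]

lemma finrank_std (k : Fin 5) : Module.finrank (ZMod 2) (lineOf (stdLab k)) = 2 := by
  have := (lin_indep_iff (stdLab k)).2 (by revert k; decide)
  have h2 := finrank_span_eq_card this
  rw [lineOf_eq_span]
  rw [Matrix.range_cons_cons_empty] at h2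
  simpa using h2

lemma exists_lab (W : Submodule (ZMod 2) Mspace) (hW : Module.finrank (ZMod 2) W = 2) :
    ∃ h : Fin 6 → Fin 4, W = lineOf h ∧
      ∀ s t c : ZMod 2, (∀ i, s * cA (h i) + t * cB (h i) = c) → s = 0 ∧ t = 0 := by
  let b := Module.finBasisOfFinrankEq (ZMod 2) W hW
  obtain ⟨f, hf⟩ := Submodule.Quotient.mk_surjective _ (b 0 : Mspace)
  obtain ⟨g, hg⟩ := Submodule.Quotient.mk_surjective _ (b 1 : Mspace)
  have eA : cA ∘ (fun i => enc (f i) (g i)) = f := by ext i; simp [cA_enc]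
  have eB : cB ∘ (fun i => enc (f i) (g i)) = g := by ext i; simp [cB_enc]
  have eb : (W.subtype ∘ b) = ![(b 0 : Mspace), (b 1 : Mspace)] := by
    ext i; fin_cases i <;> rfl
  refine ⟨fun i => enc (f i) (g i), ?_, ?_⟩
  · rw [lineOf_eq_span, eA, eB, hf, hg]
    have h1 := congrArg (Submodule.map W.subtype) b.span_eq
    rw [Submodule.map_span, ← Set.range_comp, eb] at h1
    rw [Matrix.range_cons_cons_empty] at h1
    simpa using h1.symm
  · rw [← lin_indep_iff, eA, eB, hf, hg, ← eb]
    exact b.linearIndependent.map' W.subtype (by simp)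

/-- Fibre sizes. -/
def cnt (h : Fin 6 → Fin 4) (x : Fin 4) : ℕ := Fintype.card {i // h i = x}

lemma cnt_sum (h : Fin 6 → Fin 4) : ∑ x, cnt h x = 6 := by
  have := Fintype.card_congr (Equiv.sigmaFiberEquiv h)
  rw [Fintype.card_sigma] at this
  simpa [cnt] using this

lemma cnt_pos (h : Fin 6 → Fin 4)
    (H : ∀ s t c : ZMod 2, (∀ i, s * cA (h i) + t * cB (h i) = c) → s = 0 ∧ t = 0) :
    ∀ x y, x ≠ y → 0 < cnt h x + cnt h y := by
  intro x y hxy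
  by_contra hc
  have h1 : cnt h x = 0 := by omega
  have h2 : cnt h y = 0 := by omega
  rw [cnt, Fintype.card_eq_zero_iff] at h1 h2
  have key : ∀ x y : Fin 4, x ≠ y → ∃ s t c : ZMod 2, ¬ (s = 0 ∧ t = 0) ∧
    ∀ z, z ≠ x → z ≠ y → s * cA z + t * cB z = c := by decide
  obtain ⟨s, t, c, hn, hz⟩ := key x y hxy
  exact hn (H s t c fun i => hz _ (fun e => h1.false ⟨i, e⟩) (fun e => h2.false ⟨i, e⟩))

lemma exists_std (h : Fin 6 → Fin 4)
    (H : ∀ s t c : ZMod 2, (∀ i, s * cA (h i) + t * cB (h i) = c) → s = 0 ∧ t = 0) :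
    ∃ (k : Fin 5) (τ : Equiv.Perm (Fin 4)), ∀ x, cnt (τ ∘ h) x = cnt (stdLab k) x := by
  let ρ := Tuple.sort (cnt h)
  have hm : Monotone (cnt h ∘ ρ) := Tuple.monotone_sort (cnt h)
  have hs : ∑ x, cnt h (ρ x) = 6 := (Equiv.sum_comp ρ (cnt h)).trans (cnt_sum h)
  have hp : 0 < cnt h (ρ 0) + cnt h (ρ 1) := cnt_pos h H _ _ (by simp)
  have hc : ∀ x, cnt (ρ.symm ∘ h) x = cnt h (ρ x) := by
    intro x
    refine Fintype.card_congr (Equiv.subtypeEquivRight fun i => ?_)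
    simp [Equiv.symm_apply_eq]
  have m0 : cnt h (ρ 0) ≤ cnt h (ρ 1) := hm (by decide)
  have m1 : cnt h (ρ 1) ≤ cnt h (ρ 2) := hm (by decide)
  have m2 : cnt h (ρ 2) ≤ cnt h (ρ 3) := hm (by decide)
  rw [Fin.sum_univ_four] at hs
  have hstd : ∀ k x, cnt (stdLab k) x =
    (![![0, 1, 1, 4], ![0, 1, 2, 3], ![0, 2, 2, 2], ![1, 1, 1, 3], ![1, 1, 2, 2]] :
      Fin 5 → Fin 4 → ℕ) k x := by decide
  have : ∃ k : Fin 5, ∀ x, cnt h (ρ x) = cnt (stdLab k) x := by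
    by_contra hn
    have build : ∀ k : Fin 5, cnt h (ρ 0) = cnt (stdLab k) 0 → cnt h (ρ 1) = cnt (stdLab k) 1 →
        cnt h (ρ 2) = cnt (stdLab k) 2 → cnt h (ρ 3) = cnt (stdLab k) 3 →
        False := by
      intro k h0 h1 h2 h3
      refine hn ⟨k, fun x => ?_⟩
      fin_cases x
      exacts [h0, h1, h2, h3]
    have b0 := build 0
    have b1 := build 1
    have b2 := build 2
    have b3 := build 3
    have b4 := build 4
    simp [hstd] at b0 b1 b2 b3 b4
    clear hn build
    omega
  obtain ⟨k, hk⟩ := this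
  exact ⟨k, ρ.symm, fun x => (hc x).trans (hk x)⟩

lemma exists_perm (h g : Fin 6 → Fin 4) (H : ∀ x, cnt h x = cnt g x) :
    ∃ σ : Equiv.Perm (Fin 6), ∀ i, g (σ i) = h i := by
  let e : ∀ x, {i // h i = x} ≃ {i // g i = x} := fun x => Fintype.equivOfCardEq (H x)
  exact ⟨Equiv.ofFiberEquiv e, fun i => Equiv.ofFiberEquiv_map e i⟩

/-- The action of `Perm (Fin 6)` on the 2-dimensional `F₂`-subspaces of `M` has exactly
5 orbits: the 5 types of Veldkamp lines of GQ(2,2). -/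
theorem GQ_veldkamp_line_orbits :
    Nat.card (Quot (fun (W₁ W₂ : {W : Submodule (ZMod 2) Mspace //
        Module.finrank (ZMod 2) W = 2}) =>
      ∃ σ : Equiv.Perm (Fin 6),
        Submodule.map (quotPerm σ : Mspace →ₗ[ZMod 2] Mspace) W₁.1 = W₂.1)) = 5 := by
  symm
  rw [← Nat.card_fin 5]
  refine Nat.card_eq_of_bijective
    (fun k : Fin 5 => Quot.mk _ ⟨lineOf (stdLab k), finrank_std k⟩) ⟨?_, ?_⟩
  · intro k l hkl
    have h1 := congrArg (Quot.lift (fun W : {W : Submodule (ZMod 2) Mspace //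
        Module.finrank (ZMod 2) W = 2} => (agree W.1).ncard) (by
      rintro W₁ W₂ ⟨σ, hσ⟩
      simp only [← hσ, agree_map])) hkl
    change (agree (lineOf (stdLab k))).ncard = (agree (lineOf (stdLab l))).ncard at h1
    have hv : ∀ k, (agree (lineOf (stdLab k))).ncard = (![66, 36, 24, 30, 18] : Fin 5 → ℕ) k := by
      intro k
      rw [agree_lineOf]
      revert k
      decide +kernel
    rw [hv, hv] at h1
    clear hkl hv
    revert k l
    decide
  · intro q
    obtain ⟨⟨W, hW⟩, rfl⟩ := Quot.exists_rep q
    obtain ⟨h, rfl, H⟩ := exists_lab W hW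
    obtain ⟨k, τ, hk⟩ := exists_std h H
    obtain ⟨σ, hσ⟩ := exists_perm _ _ (fun x => (hk x).symm)
    refine ⟨k, Quot.sound ⟨σ, ?_⟩⟩
    change (lineOf (stdLab k)).map (quotPerm σ : Mspace →ₗ[ZMod 2] Mspace) = lineOf h
    rw [lineOf_map, ← lineOf_comp_left h τ]
    congr 1
    ext i
    simp [← hσ]
end
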